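/- arXiv:1206.6573 — 3 statements merged into one kernel-verified Lean document; each statement's English description precedes it below -/
import Mathlib

section
/- Conservativity of Paraconsistent Non-dependence Logic over First Order Logic: for every first-order sentence φ (containing no dependence atoms) and every model M of its signature: M ⊨ₚ⁺ φ if and only if M ⊨ φ in the sense of Tarski semantics, and this holds if and only if M ⊨⁺ φ in Team Semantics. -/
/-! ## Dependence Logic: syntax, Tarski semantics, Team Semantics,
    Paraconsistent Team Semantics.

Variable assignments are total functions `ℕ → M.Dom`, so every team has
domain the set of all variables, and conditions like `Free(ψ) ⊆ Dom(X)`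
hold automatically. The team `{∅}` consisting of the empty assignment is
represented by the singleton team of a fixed (arbitrary) assignment. -/

/-- A first-order signature: relation and function symbols with arities. -/
structure Signature : Type 1 where
  Rel : Type
  relArity : Rel → ℕ
  Func : Type
  funcArity : Func → ℕ

/-- First-order terms over a signature, with variables indexed by `ℕ`. -/
inductive Term (Sig : Signature) : Type where
  | var : ℕ → Term Sig
  | func : (f : Sig.Func) → (Fin (Sig.funcArity f) → Term Sig) → Term Sig

/-- A first-order model for a signature (with nonempty domain). -/
structure Model (Sig : Signature) : Type 1 where
  Dom : Type
  nonempty : Nonempty Dom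
  relInterp : (R : Sig.Rel) → (Fin (Sig.relArity R) → Dom) → Prop
  funcInterp : (f : Sig.Func) → (Fin (Sig.funcArity f) → Dom) → Dom

variable {Sig : Signature}

/-- Evaluation of a term under an assignment. -/
def Term.eval (M : Model Sig) (s : ℕ → M.Dom) : Term Sig → M.Dom
  | .var v => s v
  | .func f ts => M.funcInterp f (fun i => (ts i).eval M s)

/-- The set of variables occurring in a term. -/
def Term.vars : Term Sig → Set ℕ
  | .var v => {v}
  | .func _ ts => ⋃ i, (ts i).vars

/-- Formulas of Dependence Logic: first-order atoms `R t⃗` and `t₁ = t₂`,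
dependence atoms `=(t⃗₁, t⃗₂)`, negation, disjunction, existential
quantification. -/
inductive DLFormula (Sig : Signature) : Type where
  | rel : (R : Sig.Rel) → (Fin (Sig.relArity R) → Term Sig) → DLFormula Sig
  | eq : Term Sig → Term Sig → DLFormula Sig
  | dep : (n m : ℕ) → (Fin n → Term Sig) → (Fin m → Term Sig) → DLFormula Sig
  | neg : DLFormula Sig → DLFormula Sig
  | or : DLFormula Sig → DLFormula Sig → DLFormula Sig
  | ex : ℕ → DLFormula Sig → DLFormula Sig

/-- `ψ ∧ θ` abbreviates `¬(¬ψ ∨ ¬θ)`. -/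
def DLFormula.conj (ψ θ : DLFormula Sig) : DLFormula Sig := (ψ.neg.or θ.neg).neg

/-- `∀v ψ` abbreviates `¬∃v ¬ψ`. -/
def DLFormula.all (v : ℕ) (ψ : DLFormula Sig) : DLFormula Sig := ((ψ.neg).ex v).neg

/-- Free variables of a Dependence Logic formula. -/
def DLFormula.free : DLFormula Sig → Set ℕ
  | .rel _ ts => ⋃ i, (ts i).vars
  | .eq t₁ t₂ => t₁.vars ∪ t₂.vars
  | .dep _ _ ts₁ ts₂ => (⋃ i, (ts₁ i).vars) ∪ ⋃ j, (ts₂ j).vars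
  | .neg ψ => ψ.free
  | .or ψ θ => ψ.free ∪ θ.free
  | .ex v ψ => ψ.free \ {v}

/-- A formula is first-order if it contains no dependence atoms. -/
def DLFormula.IsFirstOrder : DLFormula Sig → Prop
  | .rel _ _ => True
  | .eq _ _ => True
  | .dep _ _ _ _ => False
  | .neg ψ => ψ.IsFirstOrder
  | .or ψ θ => ψ.IsFirstOrder ∧ θ.IsFirstOrder
  | .ex _ ψ => ψ.IsFirstOrder

/-- Tarski satisfaction `M ⊨_s ψ` (meaningful for first-order formulas;
dependence atoms are given the trivial interpretation). -/
def Tarski (M : Model Sig) (s : ℕ → M.Dom) : DLFormula Sig → Prop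
  | .rel R ts => M.relInterp R (fun i => (ts i).eval M s)
  | .eq t₁ t₂ => t₁.eval M s = t₂.eval M s
  | .dep _ _ _ _ => True
  | .neg ψ => ¬ Tarski M s ψ
  | .or ψ θ => Tarski M s ψ ∨ Tarski M s θ
  | .ex v ψ => ∃ m : M.Dom, Tarski M (Function.update s v m) ψ

/-- The team `X[F/v] = {s[m/v] : s ∈ X, m ∈ F(s)}`. -/
def teamSup {M : Model Sig} (X : Set (ℕ → M.Dom)) (v : ℕ)
    (F : (ℕ → M.Dom) → Set M.Dom) : Set (ℕ → M.Dom) :=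
  {s' | ∃ s ∈ X, ∃ m ∈ F s, s' = Function.update s v m}

/-- The team `X[M/v] = {s[m/v] : s ∈ X, m ∈ Dom(M)}`. -/
def teamSupAll {M : Model Sig} (X : Set (ℕ → M.Dom)) (v : ℕ) : Set (ℕ → M.Dom) :=
  {s' | ∃ s ∈ X, ∃ m : M.Dom, s' = Function.update s v m}

/-- Team Semantics: `TeamSat M true X ψ` is `(M,X) ⊨⁺ ψ` and
`TeamSat M false X ψ` is `(M,X) ⊨⁻ ψ`. -/
def TeamSat (M : Model Sig) : Bool → Set (ℕ → M.Dom) → DLFormula Sig → Prop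
  | true, X, .rel R ts => ∀ s ∈ X, M.relInterp R (fun i => (ts i).eval M s)
  | false, X, .rel R ts => ∀ s ∈ X, ¬ M.relInterp R (fun i => (ts i).eval M s)
  | true, X, .eq t₁ t₂ => ∀ s ∈ X, t₁.eval M s = t₂.eval M s
  | false, X, .eq t₁ t₂ => ∀ s ∈ X, t₁.eval M s ≠ t₂.eval M s
  | true, X, .dep _ _ ts₁ ts₂ => ∀ s ∈ X, ∀ s' ∈ X,
      (∀ i, (ts₁ i).eval M s = (ts₁ i).eval M s') →
        ∀ j, (ts₂ j).eval M s = (ts₂ j).eval M s'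
  | false, X, .dep _ _ _ _ => X = ∅
  | d, X, .neg ψ => TeamSat M (!d) X ψ
  | true, X, .or ψ θ => ∃ Y Z, X = Y ∪ Z ∧ TeamSat M true Y ψ ∧ TeamSat M true Z θ
  | false, X, .or ψ θ => TeamSat M false X ψ ∧ TeamSat M false X θ
  | true, X, .ex v ψ => ∃ F : (ℕ → M.Dom) → Set M.Dom,
      (∀ s ∈ X, (F s).Nonempty) ∧ TeamSat M true (teamSup X v F) ψ
  | false, X, .ex v ψ => TeamSat M false (teamSupAll X v) ψ

/-- A fixed (arbitrary) assignment, playing the role of the empty assignment. -/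
noncomputable def Model.defAsg (M : Model Sig) : ℕ → M.Dom :=
  fun _ => Classical.choice M.nonempty

/-- Truth/falsity of a sentence: `M ⊨ᵈ φ` iff `(M, {∅}) ⊨ᵈ φ`. -/
def Model.sat (M : Model Sig) (d : Bool) (φ : DLFormula Sig) : Prop :=
  TeamSat M d {M.defAsg} φ

/-- Paraconsistent Team Semantics: `(M,X) ⊨ₚᵈ ψ` iff `(M,X) ⊭^{d*} ψ`. -/
def PTeamSat (M : Model Sig) (d : Bool) (X : Set (ℕ → M.Dom))
    (ψ : DLFormula Sig) : Prop :=
  ¬ TeamSat M (!d) X ψ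

/-- Paraconsistent truth/falsity of a sentence. -/
def Model.psat (M : Model Sig) (d : Bool) (φ : DLFormula Sig) : Prop :=
  PTeamSat M d {M.defAsg} φ

theorem Term.eval_congr (M : Model Sig) (t : Term Sig) {s s' : ℕ → M.Dom}
    (h : Set.EqOn s s' t.vars) : t.eval M s = t.eval M s' := by
  induction t with
  | var v => exact h rfl
  | func f ts ih =>
    simp only [Term.eval]
    congr 1
    funext i
    exact ih i (h.mono (Set.subset_iUnion (fun i => (ts i).vars) i))

theorem tarski_congr (M : Model Sig) (ψ : DLFormula Sig) {s s' : ℕ → M.Dom}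
    (h : Set.EqOn s s' ψ.free) : Tarski M s ψ ↔ Tarski M s' ψ := by
  induction ψ generalizing s s' with
  | rel R ts =>
    have hts : ∀ i, (ts i).eval M s = (ts i).eval M s' := fun i =>
      (ts i).eval_congr M (h.mono (Set.subset_iUnion (fun i => (ts i).vars) i))
    simp only [Tarski, hts]
  | eq t₁ t₂ =>
    simp only [Tarski, t₁.eval_congr M (h.mono Set.subset_union_left),
      t₂.eval_congr M (h.mono Set.subset_union_right)]
  | dep n m ts₁ ts₂ => exact Iff.rfl
  | neg ψ ih => exact not_congr (ih h)
  | or ψ θ ihψ ihθ =>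
    exact or_congr (ihψ (h.mono Set.subset_union_left)) (ihθ (h.mono Set.subset_union_right))
  | ex v ψ ih =>
    refine exists_congr fun m => ih fun w hw => ?_
    by_cases hwv : w = v
    · simp [hwv]
    · simpa [hwv] using h ⟨hw, hwv⟩

/-- First-order formulas are flat: a team satisfies (resp. dissatisfies) them iff each of its
assignments does so in Tarski semantics. -/
theorem teamSat_iff_forall_tarski (M : Model Sig) (ψ : DLFormula Sig) (hψ : ψ.IsFirstOrder)
    (X : Set (ℕ → M.Dom)) :
    (TeamSat M true X ψ ↔ ∀ s ∈ X, Tarski M s ψ) ∧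
      (TeamSat M false X ψ ↔ ∀ s ∈ X, ¬ Tarski M s ψ) := by
  induction ψ generalizing X with
  | rel R ts => simp [TeamSat, Tarski]
  | eq t₁ t₂ => simp [TeamSat, Tarski]
  | dep n m ts₁ ts₂ => exact hψ.elim
  | neg ψ ih =>
    obtain ⟨hpos, hneg⟩ := ih hψ X
    simp [TeamSat, Tarski, hpos, hneg]
  | or ψ θ ihψ ihθ =>
    simp only [TeamSat, Tarski, ihψ hψ.1, ihθ hψ.2]
    refine ⟨⟨?_, fun h => ?_⟩, ?_⟩
    · rintro ⟨Y, Z, rfl, hY, hZ⟩ s (hs | hs)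
      exacts [Or.inl (hY s hs), Or.inr (hZ s hs)]
    · refine ⟨{s ∈ X | Tarski M s ψ}, {s ∈ X | Tarski M s θ}, ?_, fun s hs => hs.2,
        fun s hs => hs.2⟩
      ext s
      exact ⟨fun hs => (h s hs).imp (⟨hs, ·⟩) (⟨hs, ·⟩), fun hs => hs.elim And.left And.left⟩
    · simp only [not_or, forall_and]
  | ex v ψ ih =>
    simp only [TeamSat, Tarski, ih hψ]
    refine ⟨⟨?_, fun h => ?_⟩, ?_⟩
    · rintro ⟨F, hF, h⟩ s hs
      obtain ⟨m, hm⟩ := hF s hs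
      exact ⟨m, h _ ⟨s, hs, m, hm, rfl⟩⟩
    · refine ⟨fun s => {m | Tarski M (Function.update s v m) ψ}, h, ?_⟩
      rintro _ ⟨s, -, m, hm, rfl⟩
      exact hm
    · constructor
      · rintro h s hs ⟨m, hm⟩
        exact h _ ⟨s, hs, m, rfl⟩ hm
      · rintro h _ ⟨s, hs, m, rfl⟩ hm
        exact h s hs ⟨m, hm⟩

/-- conservativity over First Order Logic: for a first-order
sentence, paraconsistent truth, Tarski truth and Team-Semantics truth agree. -/
theorem stmt11 (Sig : Signature) (M : Model Sig) (φ : DLFormula Sig)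
    (hFO : φ.IsFirstOrder) (hSent : φ.free = ∅) :
    (M.psat true φ ↔ ∀ s : ℕ → M.Dom, Tarski M s φ) ∧
    ((∀ s : ℕ → M.Dom, Tarski M s φ) ↔ M.sat true φ) := by
  have hdef : (∀ s : ℕ → M.Dom, Tarski M s φ) ↔ Tarski M M.defAsg φ :=
    ⟨fun h => h _, fun h s =>
      (tarski_congr M φ (by rw [hSent]; exact Set.eqOn_empty _ _)).mp h⟩
  have hflat := teamSat_iff_forall_tarski M φ hFO {M.defAsg}
  rw [hdef]
  simp [Model.psat, PTeamSat, Model.sat, hflat]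
end

section
/- Upwards Closure: for every model M, every Dependence Logic formula ψ over the signature of M, all teams X, Y over M with the same domain containing Free(ψ) and with X ⊆ Y, and every sign d ∈ {+, −}: if (M, X) ⊨ₚᵈ ψ then (M, Y) ⊨ₚᵈ ψ. -/
variable {Sig : Signature}

theorem teamSup_mono {M : Model Sig} {X Y : Set (ℕ → M.Dom)} (hXY : X ⊆ Y) (v : ℕ)
    (F : (ℕ → M.Dom) → Set M.Dom) : teamSup X v F ⊆ teamSup Y v F := by
  rintro _ ⟨s, hs, m, hm, rfl⟩
  exact ⟨s, hXY hs, m, hm, rfl⟩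

theorem teamSupAll_mono {M : Model Sig} {X Y : Set (ℕ → M.Dom)} (hXY : X ⊆ Y) (v : ℕ) :
    teamSupAll X v ⊆ teamSupAll Y v := by
  rintro _ ⟨s, hs, m, rfl⟩
  exact ⟨s, hXY hs, m, rfl⟩

/-- Downwards Closure for Team Semantics. -/
theorem TeamSat.anti {M : Model Sig} {ψ : DLFormula Sig} {X Y : Set (ℕ → M.Dom)}
    (hXY : X ⊆ Y) {d : Bool} (h : TeamSat M d Y ψ) : TeamSat M d X ψ := by
  induction ψ generalizing X Y d with
  | rel R ts =>
    cases d <;> simp only [TeamSat] at h ⊢ <;> exact fun s hs => h s (hXY hs)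
  | eq t₁ t₂ =>
    cases d <;> simp only [TeamSat] at h ⊢ <;> exact fun s hs => h s (hXY hs)
  | dep n m ts₁ ts₂ =>
    cases d <;> simp only [TeamSat] at h ⊢
    · exact Set.subset_eq_empty hXY h
    · exact fun s hs s' hs' => h s (hXY hs) s' (hXY hs')
  | neg ψ ih =>
    simp only [TeamSat] at h ⊢
    exact ih hXY h
  | or ψ θ ihψ ihθ =>
    cases d <;> simp only [TeamSat] at h ⊢
    · exact ⟨ihψ hXY h.1, ihθ hXY h.2⟩
    · obtain ⟨A, B, rfl, hA, hB⟩ := h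
      refine ⟨X ∩ A, X ∩ B, ?_, ihψ Set.inter_subset_right hA, ihθ Set.inter_subset_right hB⟩
      rw [← Set.inter_union_distrib_left, Set.inter_eq_left.mpr hXY]
  | ex v ψ ih =>
    cases d <;> simp only [TeamSat] at h ⊢
    · exact ih (teamSupAll_mono hXY v) h
    · obtain ⟨F, hF, hψ⟩ := h
      exact ⟨F, fun s hs => hF s (hXY hs), ih (teamSup_mono hXY v F) hψ⟩

/-- Upwards Closure for Paraconsistent Team Semantics. -/
theorem stmt13 (Sig : Signature) (M : Model Sig) (ψ : DLFormula Sig)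
    (X Y : Set (ℕ → M.Dom)) (hXY : X ⊆ Y) (d : Bool)
    (h : PTeamSat M d X ψ) : PTeamSat M d Y ψ :=
  fun hY => h (hY.anti hXY)
end

section
/- Consistent sentences of Paraconsistent Non-dependence Logic are first-order: if φ is a Dependence Logic sentence that is consistent under Paraconsistent Team Semantics (i.e. there is no model M with both M ⊨ₚ⁺ φ and M ⊨ₚ⁻ φ), then φ is logically equivalent to its flattening φᶠ, i.e. for every model M and every sign d ∈ {+, −}: M ⊨ₚᵈ φ if and only if M ⊨ₚᵈ φᶠ. -/
variable {Sig : Signature}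

/-- The flattening of a formula: dependence atoms are replaced by the
tautological atom `⊤` (rendered as `x₀ = x₀`). -/
def DLFormula.flat : DLFormula Sig → DLFormula Sig
  | .rel R ts => .rel R ts
  | .eq t₁ t₂ => .eq t₁ t₂
  | .dep _ _ _ _ => .eq (.var 0) (.var 0)
  | .neg ψ => ψ.flat.neg
  | .or ψ θ => ψ.flat.or θ.flat
  | .ex v ψ => .ex v ψ.flat

theorem DLFormula.flat_isFirstOrder (ψ : DLFormula Sig) : ψ.flat.IsFirstOrder := by
  induction ψ <;> simp_all [DLFormula.flat, DLFormula.IsFirstOrder]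

theorem tarski_flat (M : Model Sig) (ψ : DLFormula Sig) (s : ℕ → M.Dom) :
    Tarski M s ψ.flat ↔ Tarski M s ψ := by
  induction ψ generalizing s <;> simp_all [DLFormula.flat, Tarski]

/-- Every assignment of a team that supports `ψ` positively (negatively) makes `ψ` true (false)
under Tarski semantics, where dependence atoms are read as true. -/
theorem TeamSat.tarski_iff {M : Model Sig} {ψ : DLFormula Sig} {d : Bool}
    {X : Set (ℕ → M.Dom)} (h : TeamSat M d X ψ) {s : ℕ → M.Dom} (hs : s ∈ X) :
    Tarski M s ψ ↔ d = true := by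
  induction ψ generalizing d X s with
  | rel R ts => cases d <;> simpa [Tarski] using h s hs
  | eq t₁ t₂ => cases d <;> simpa [Tarski] using h s hs
  | dep n m ts₁ ts₂ =>
    cases d
    · simp only [TeamSat] at h
      simp [h] at hs
    · simp [Tarski]
  | neg ψ ih =>
    have h' : TeamSat M (!d) X ψ := by cases d <;> simpa only [TeamSat] using h
    have := ih h' hs
    cases d <;> simpa [Tarski] using this
  | or ψ θ ihψ ihθ =>
    cases d
    · simp only [TeamSat] at h
      simp [Tarski, ihψ h.1 hs, ihθ h.2 hs]
    · simp only [TeamSat] at h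
      obtain ⟨Y, Z, rfl, hY, hZ⟩ := h
      rcases hs with hs | hs
      · simp [Tarski, ihψ hY hs]
      · simp [Tarski, ihθ hZ hs]
  | ex v ψ ih =>
    cases d
    · simp only [TeamSat] at h
      simp only [Tarski, Bool.false_eq_true, iff_false, not_exists]
      intro m
      simpa using ih h ⟨s, hs, m, rfl⟩
    · simp only [TeamSat] at h
      obtain ⟨F, hF, h⟩ := h
      obtain ⟨m, hm⟩ := hF s hs
      simpa [Tarski] using ⟨m, (ih h ⟨s, hs, m, hm, rfl⟩).2 rfl⟩

theorem DLFormula.IsFirstOrder.teamSat {M : Model Sig} {ψ : DLFormula Sig}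
    (hψ : ψ.IsFirstOrder) {d : Bool} {X : Set (ℕ → M.Dom)}
    (h : ∀ s ∈ X, Tarski M s ψ ↔ d = true) : TeamSat M d X ψ := by
  induction ψ generalizing d X with
  | rel R ts => cases d <;> simpa [Tarski, TeamSat] using h
  | eq t₁ t₂ => cases d <;> simpa [Tarski, TeamSat] using h
  | dep n m ts₁ ts₂ => exact hψ.elim
  | neg ψ ih =>
    have h' : TeamSat M (!d) X ψ :=
      ih hψ fun s hs => by have := h s hs; cases d <;> simpa [Tarski] using this
    cases d <;> simpa only [TeamSat] using h'
  | or ψ θ ihψ ihθ =>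
    cases d
    · simp only [TeamSat]
      simp only [Tarski, Bool.false_eq_true, iff_false, not_or] at h
      exact ⟨ihψ hψ.1 fun s hs => by simpa using (h s hs).1,
        ihθ hψ.2 fun s hs => by simpa using (h s hs).2⟩
    · simp only [TeamSat]
      refine ⟨{s ∈ X | Tarski M s ψ}, {s ∈ X | Tarski M s θ}, ?_,
        ihψ hψ.1 fun s hs => by simpa using hs.2, ihθ hψ.2 fun s hs => by simpa using hs.2⟩
      ext s
      have := h s
      simp only [Tarski, iff_true] at this
      simp only [Set.mem_union, Set.mem_ofPred_eq]
      tauto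
  | ex v ψ ih =>
    cases d
    · simp only [TeamSat]
      apply ih hψ
      rintro _ ⟨s, hs, m, rfl⟩
      have := h s hs
      simp only [Tarski, Bool.false_eq_true, iff_false, not_exists] at this
      simpa using this m
    · simp only [TeamSat]
      refine ⟨fun s => {m | Tarski M (Function.update s v m) ψ},
        fun s hs => (h s hs).2 rfl, ih hψ ?_⟩
      rintro _ ⟨s, hs, m, hm, rfl⟩
      simpa using hm

/-- Flattening weakens team semantics: support of `ψ` implies support of its flattening. -/
theorem TeamSat.flat {M : Model Sig} {ψ : DLFormula Sig} {d : Bool}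
    {X : Set (ℕ → M.Dom)} (h : TeamSat M d X ψ) : TeamSat M d X ψ.flat :=
  ψ.flat_isFirstOrder.teamSat fun s hs => (tarski_flat M ψ s).trans (h.tarski_iff hs)

/-- a sentence that is consistent under Paraconsistent Team
Semantics is logically equivalent to its (first-order) flattening. -/
theorem stmt18 (Sig : Signature) (φ : DLFormula Sig) (hSent : φ.free = ∅)
    (hCons : ¬ ∃ M : Model Sig, M.psat true φ ∧ M.psat false φ) :
    ∀ (M : Model Sig) (d : Bool), M.psat d φ ↔ M.psat d φ.flat := by
  intro M d
  refine not_congr ⟨TeamSat.flat, fun hflat => ?_⟩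
  obtain ⟨e, he⟩ : ∃ e, TeamSat M e {M.defAsg} φ := by
    by_contra! hnone
    exact hCons ⟨M, hnone _, hnone _⟩
  have hmem := Set.mem_singleton M.defAsg
  have key : (e = true) ↔ ((!d) = true) :=
    (he.flat.tarski_iff hmem).symm.trans (hflat.tarski_iff hmem)
  rwa [← Bool.eq_iff_iff.2 key]
end
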